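/- Let d ≥ 1, let m ≥ 3 be an integer and n ≥ 2 an integer with m^{5d/4}·8^d·3^{dm} ≤ √n, let J = {1,3,…,2m−1}^d, and let ε = c·n^{−1/2}·m^{−d/4} for some c ∈ (0,1). Then for every α = (α_j)_{j∈J} ∈ {0,1}^J and every u ∈ ℝ^d, the perturbed mixing density satisfies γ(u) + ε·Σ_{j∈J} α_j γ_j(u) ≥ (1−c)·γ(u) ≥ 0, where γ(u) = φ_m(u_1)···φ_m(u_d) and γ_j(u) = γ_{j_1}(u_1)···γ_{j_d}(u_d) with γ_{j_i}(u) := 2^{1/2}(2π)^{3/4}·√(3^{j_i}/j_i!)·φ(u)·H_{j_i}(2u/√3). -/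

import Mathlib

open Real MeasureTheory

noncomputable def gauss (x : ℝ) : ℝ := Real.exp (-(x^2)/2) / Real.sqrt (2*Real.pi)

/-- The univariate normal density with mean 0 and variance `s`. -/
noncomputable def gaussVar (s : ℝ) (x : ℝ) : ℝ :=
  Real.exp (-(x^2)/(2*s)) / Real.sqrt (2*Real.pi*s)

/-- The probabilists' Hermite polynomial `H_j` evaluated at a real number. -/
noncomputable def hermiteEval (j : ℕ) (x : ℝ) : ℝ :=
  Polynomial.aeval x (Polynomial.hermite j)

/-- The Hermite perturbation function
`γ_j(u) = 2^{1/2} (2π)^{3/4} √(3^j/j!) φ(u) H_j(2u/√3)`. -/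
noncomputable def gammaPert (j : ℕ) (u : ℝ) : ℝ :=
  Real.sqrt 2 * (2 * Real.pi) ^ ((3 : ℝ)/4) *
    Real.sqrt (3 ^ j / (Nat.factorial j)) * gauss u *
    hermiteEval j (2 * u / Real.sqrt 3)

/- The index set `J = {1, 3, …, 2m-1}^d` is encoded as `Fin d → Fin m`, with
`k : Fin d → Fin m` corresponding to the multi-index `j` with `j i = 2 * k i + 1`. -/

lemma hermite_deriv_succ (n : ℕ) : Polynomial.derivative (Polynomial.hermite (n+1)) =
    ((n : Polynomial ℤ) + 1) * Polynomial.hermite n := by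
  induction n with
  | zero => simp
  | succ k ih =>
    rw [Polynomial.hermite_succ (k+1)]
    simp only [Polynomial.derivative_sub, Polynomial.derivative_mul, Polynomial.derivative_X, ih,
      Polynomial.derivative_add, Polynomial.derivative_natCast, Polynomial.derivative_one]
    rw [Polynomial.hermite_succ k]
    push_cast
    ring

lemma hE_zero (x : ℝ) : hermiteEval 0 x = 1 := by simp [hermiteEval]

lemma hE_one (x : ℝ) : hermiteEval 1 x = x := by simp [hermiteEval]

lemma hE_rec (n : ℕ) (x : ℝ) :
    hermiteEval (n+2) x = x * hermiteEval (n+1) x - (n+1) * hermiteEval n x := by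
  unfold hermiteEval
  rw [Polynomial.hermite_succ (n+1), hermite_deriv_succ]
  simp

lemma hE_deriv (n : ℕ) (x : ℝ) :
    HasDerivAt (hermiteEval (n+1)) ((n+1) * hermiteEval n x) x := by
  have h := (Polynomial.hermite (n+1)).hasDerivAt_aeval (𝕜 := ℝ) x
  rw [hermite_deriv_succ] at h
  refine HasDerivAt.congr_deriv h ?_
  simp [hermiteEval]

lemma hE_deriv' (n : ℕ) (x : ℝ) :
    HasDerivAt (hermiteEval n) (x * hermiteEval n x - hermiteEval (n+1) x) x := by
  have h := (Polynomial.hermite n).hasDerivAt_aeval (𝕜 := ℝ) x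
  have e : Polynomial.aeval x (Polynomial.derivative (Polynomial.hermite n)) =
      x * hermiteEval n x - hermiteEval (n+1) x := by
    unfold hermiteEval
    rw [Polynomial.hermite_succ n]
    simp
  rw [e] at h
  exact h

lemma hE_neg (n : ℕ) (x : ℝ) : hermiteEval n (-x) = (-1)^n * hermiteEval n x ∧
    hermiteEval (n+1) (-x) = (-1)^(n+1) * hermiteEval (n+1) x := by
  induction n with
  | zero => simp [hE_zero, hE_one]
  | succ k ih =>
    refine ⟨ih.2, ?_⟩
    rw [hE_rec, hE_rec, ih.1, ih.2]
    ring

lemma hE_sq_abs (n : ℕ) (x : ℝ) : hermiteEval n |x| ^ 2 = hermiteEval n x ^ 2 := by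
  rcases abs_choice x with h | h
  · rw [h]
  · rw [h, (hE_neg n x).1, mul_pow, ← pow_mul, mul_comm n 2, pow_mul]; simp

/-- Christoffel-Darboux. -/
lemma hE_CD (n : ℕ) (x : ℝ) :
    ∑ j ∈ Finset.range (n+1), hermiteEval j x ^ 2 / (j.factorial : ℝ) =
      ((n+1) * hermiteEval n x ^ 2 + hermiteEval (n+1) x ^ 2
        - x * hermiteEval n x * hermiteEval (n+1) x) / (n.factorial : ℝ) := by
  induction n with
  | zero => simp [hE_zero, hE_one]; ring
  | succ k ih =>
    rw [Finset.sum_range_succ, ih, hE_rec, Nat.factorial_succ]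
    have : (k.factorial : ℝ) ≠ 0 := by positivity
    push_cast
    field_simp
    ring

lemma hE_zero_bound (i : ℕ) : hermiteEval (2*i+1) 0 = 0 ∧
    hermiteEval (2*i) 0 ^ 2 ≤ ((2*i).factorial : ℝ) := by
  induction i with
  | zero => simp [hE_zero, hE_one]
  | succ k ih =>
    have e1 : 2*(k+1)+1 = (2*k+1)+2 := by ring
    have e2 : 2*(k+1) = (2*k)+2 := by ring
    constructor
    · rw [e1, hE_rec, ih.1]; simp
    · rw [e2, hE_rec, Nat.factorial_succ, Nat.factorial_succ]
      push_cast
      have h := ih.2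
      have hk : (0:ℝ) ≤ k := by positivity
      have hf : (0:ℝ) ≤ ((2*k).factorial : ℝ) := by positivity
      have h2 := mul_le_mul_of_nonneg_left h (by positivity : (0:ℝ) ≤ (2*k+1)^2)
      nlinarith [mul_nonneg hk hf]

lemma S_zero_bound (k : ℕ) :
    ∑ j ∈ Finset.range (2*k), hermiteEval j 0 ^ 2 / (j.factorial : ℝ) ≤ k := by
  induction k with
  | zero => simp
  | succ k ih =>
    rw [show 2*(k+1) = 2*k+1+1 by ring, Finset.sum_range_succ, Finset.sum_range_succ,
      (hE_zero_bound k).1]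
    have : hermiteEval (2*k) 0 ^ 2 / ((2*k).factorial : ℝ) ≤ 1 := by
      rw [div_le_one (by positivity)]; exact (hE_zero_bound k).2
    push_cast
    simp only [ne_eq, OfNat.ofNat_ne_zero, not_false_eq_true, zero_pow, zero_div]
    linarith

lemma F_decay (n : ℕ) (s : ℝ) (hs : 0 ≤ s) (hs2 : s^2 = n+1) (x : ℝ) (hx0 : 0 ≤ x) (hx : x ≤ 2*s) :
    (∑ j ∈ Finset.range (n+1), hermiteEval j x ^ 2 / (j.factorial : ℝ)) * Real.exp (-(x^2)/2)
      * (2*s - x) ≤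
    (∑ j ∈ Finset.range (n+1), hermiteEval j 0 ^ 2 / (j.factorial : ℝ)) * (2*s) := by
  let P : ℝ → ℝ := fun x => (n+1) * hermiteEval n x ^ 2 + hermiteEval (n+1) x ^ 2
        - x * hermiteEval n x * hermiteEval (n+1) x
  let G : ℝ → ℝ := fun x => P x * Real.exp (-(x^2)/2) * (2*s - x)
  have hG : ∀ x, HasDerivAt G (-Real.exp (-(x^2)/2) * (P x +
      hermiteEval n x * hermiteEval (n+1) x * (2*s-x))) x := by
    intro x
    have hA := hE_deriv' n x
    have hB := hE_deriv n x
    have hI := hasDerivAt_id x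
    have hP := (((hA.pow 2).const_mul ((n:ℝ)+1)).add (hB.pow 2)).sub ((hI.mul hA).mul hB)
    have hexp := (((hI.pow 2).neg).div_const 2).exp
    have hl := hI.const_sub (2*s)
    have := (hP.mul hexp).mul hl
    refine HasDerivAt.congr_deriv (f := G) this ?_
    simp [P]
    ring
  have hanti : AntitoneOn G (Set.Icc 0 (2*s)) := by
    refine antitoneOn_of_hasDerivWithinAt_nonpos (convex_Icc _ _)
      (fun x _ => (hG x).continuousAt.continuousWithinAt)
      (fun x _ => (hG x).hasDerivWithinAt) ?_
    intro x hx
    rw [interior_Icc] at hx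
    have hx1 := hx.1
    have hx2 := hx.2
    have hpos : 0 ≤ P x + hermiteEval n x * hermiteEval (n+1) x * (2*s-x) := by
      simp only [P]
      rw [← hs2]
      set A := hermiteEval n x
      set B := hermiteEval (n+1) x
      rcases le_total 0 (A*B) with h | h
      · nlinarith [sq_nonneg (s*A-B), mul_nonneg h (sub_nonneg.2 hx2.le)]
      · nlinarith [sq_nonneg (s*A+B), mul_nonneg (neg_nonneg.2 h) hx1.le]
    nlinarith [Real.exp_pos (-(x^2)/2), mul_nonneg (Real.exp_pos (-(x^2)/2)).le hpos]
  have h := hanti (show (0:ℝ) ∈ Set.Icc 0 (2*s) from ⟨le_rfl, by linarith⟩)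
    (show x ∈ Set.Icc 0 (2*s) from ⟨hx0, hx⟩) hx0
  rw [hE_CD, hE_CD]
  have hf : (0:ℝ) < n.factorial := by positivity
  simp only [G, P] at h
  have h' := div_le_div_of_nonneg_right h hf.le
  calc _ = _ := ?_
    _ ≤ _ := h'
    _ = _ := ?_
  · ring
  · simp
    ring

lemma cramer_near (n : ℕ) (hn : 1 ≤ n) (x : ℝ) (hx0 : 0 ≤ x) (hx : x ≤ 2*√n) :
    hermiteEval n x ^ 2 / (n.factorial : ℝ) * Real.exp (-(x^2)/2) ≤ 4 * n := by
  have hn' : (1:ℝ) ≤ n := by exact_mod_cast hn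
  have hsq : √(n:ℝ)^2 = n := Real.sq_sqrt (by positivity)
  have hsp : 0 < √(n:ℝ) := Real.sqrt_pos.2 (by linarith)
  have hN : 4*n-1+1 = 2*(2*n) := by omega
  have hNr : ((4*n-1 : ℕ):ℝ) + 1 = 4*n := by
    have : ((4*n-1+1 : ℕ):ℝ) = 4*n := by rw [hN]; push_cast; ring
    push_cast at this ⊢; exact this
  have h := F_decay (4*n-1) (2*√n) (by positivity) (by rw [hNr, mul_pow, hsq]; norm_num) x hx0
    (by linarith)
  rw [hN] at h
  have h0 := S_zero_bound (2*n)
  have h1 : hermiteEval n x ^ 2 / (n.factorial : ℝ) ≤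
      ∑ j ∈ Finset.range (2*(2*n)), hermiteEval j x ^ 2 / (j.factorial : ℝ) :=
    Finset.single_le_sum (f := fun j => hermiteEval j x ^ 2 / (j.factorial : ℝ))
      (fun j _ => by positivity) (Finset.mem_range.2 (by omega))
  push_cast at h0
  have he := Real.exp_pos (-(x^2)/2)
  have h2 := mul_le_mul_of_nonneg_right h1 he.le
  have h3 : 0 ≤ hermiteEval n x ^ 2 / (n.factorial : ℝ) * Real.exp (-(x^2)/2) := by positivity
  have h4 := mul_le_mul h2 (show 2*√n ≤ 2*(2*√n) - x by linarith) (by positivity) (h3.trans h2)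
  have h5 := mul_le_mul_of_nonneg_right h0 (show 0 ≤ 2*(2*√(n:ℝ)) by positivity)
  have h6 := (h4.trans h).trans h5
  have : 2*√(n:ℝ) * (hermiteEval n x ^ 2 / (n.factorial : ℝ) * Real.exp (-(x^2)/2)) ≤
      2*√(n:ℝ) * (4*n) := by linarith
  exact le_of_mul_le_mul_left this (by positivity)

lemma hE_pos (k : ℕ) (x : ℝ) (hx : 0 < x) (h : 4*(k:ℝ) ≤ x^2) :
    0 < hermiteEval k x ∧ x/2 * hermiteEval k x ≤ hermiteEval (k+1) x := by
  induction k with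
  | zero => simp [hE_zero, hE_one]; linarith
  | succ k ih =>
    push_cast at h
    obtain ⟨h1, h2⟩ := ih (by linarith)
    refine ⟨lt_of_lt_of_le (by positivity) h2, ?_⟩
    rw [hE_rec]
    nlinarith [mul_le_mul_of_nonneg_left h2 (by linarith : 0 ≤ x/2),
      mul_le_mul_of_nonneg_right h h1.le]

lemma cramer_far (n : ℕ) (hn : 1 ≤ n) (x : ℝ) (hx : 2*√n ≤ x) :
    hermiteEval n x ^ 2 / (n.factorial : ℝ) * Real.exp (-(x^2)/2) ≤ 4 * n := by
  obtain ⟨k, rfl⟩ : ∃ k, n = k+1 := ⟨n-1, by omega⟩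
  set t := √((k+1:ℕ):ℝ) with ht
  have htsq : t^2 = k+1 := by rw [ht, Real.sq_sqrt (by positivity)]; push_cast; ring
  have htp : 0 < t := Real.sqrt_pos.2 (by positivity)
  let G : ℝ → ℝ := fun x => hermiteEval (k+1) x * Real.exp (-(x^2)/4)
  have hG : ∀ x, HasDerivAt G (Real.exp (-(x^2)/4) * ((k+1) * hermiteEval k x
      - x/2 * hermiteEval (k+1) x)) x := by
    intro x
    have hI := hasDerivAt_id x
    have hexp := (((hI.pow 2).neg).div_const 4).exp
    refine HasDerivAt.congr_deriv (f := G) ((hE_deriv k x).mul hexp) ?_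
    simp
    ring
  have hanti : AntitoneOn G (Set.Ici (2*t)) := by
    refine antitoneOn_of_hasDerivWithinAt_nonpos (convex_Ici _)
      (fun x _ => (hG x).continuousAt.continuousWithinAt)
      (fun x _ => (hG x).hasDerivWithinAt) ?_
    intro x hx
    rw [interior_Ici] at hx
    have hx' : 2*t < x := hx
    have hxp : 0 < x := by linarith
    have hx2 : 4*((k:ℝ)+1) ≤ x^2 := by nlinarith
    obtain ⟨h1, h2⟩ := hE_pos k x hxp (by linarith)
    have : (k+1) * hermiteEval k x - x/2 * hermiteEval (k+1) x ≤ 0 := by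
      nlinarith [mul_le_mul_of_nonneg_left h2 (by linarith : 0 ≤ x/2),
        mul_le_mul_of_nonneg_right hx2 h1.le]
    exact mul_nonpos_of_nonneg_of_nonpos (Real.exp_pos _).le this
  have h := hanti (show 2*t ∈ Set.Ici (2*t) from Set.mem_Ici.2 le_rfl) (show x ∈ Set.Ici (2*t) from hx) hx
  have hx2 : 4*((k:ℝ)+1) ≤ x^2 := by nlinarith
  have h0 : 0 ≤ G x := mul_nonneg (hE_pos (k+1) x (by linarith) (by push_cast; linarith)).1.le
    (Real.exp_pos _).le
  have hsq := pow_le_pow_left₀ h0 h 2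
  have hGsq : ∀ y, hermiteEval (k+1) y ^ 2 / ((k+1).factorial : ℝ) * Real.exp (-(y^2)/2) =
      G y ^ 2 / ((k+1).factorial : ℝ) := by
    intro y
    simp only [G, mul_pow]
    rw [← Real.exp_nat_mul, show ((2:ℕ):ℝ) * (-(y^2)/4) = -(y^2)/2 by push_cast; ring]
    ring
  rw [hGsq]
  refine le_trans (div_le_div_of_nonneg_right hsq (by positivity)) ?_
  rw [← hGsq]
  exact cramer_near (k+1) hn (2*t) (by positivity) le_rfl

lemma cramer (n : ℕ) (hn : 1 ≤ n) (x : ℝ) :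
    |hermiteEval n x| ≤ √(4*n) * √(n.factorial : ℝ) * Real.exp (x^2/4) := by
  have key : hermiteEval n x ^ 2 / (n.factorial : ℝ) * Real.exp (-(x^2)/2) ≤ 4 * n := by
    rw [← hE_sq_abs, ← sq_abs x]
    rcases le_total |x| (2*√n) with h | h
    · exact cramer_near n hn _ (abs_nonneg x) h
    · exact cramer_far n hn _ h
  apply abs_le_of_sq_le_sq _ (by positivity)
  rw [mul_pow, mul_pow, Real.sq_sqrt (by positivity), Real.sq_sqrt (by positivity),
    ← Real.exp_nat_mul, show ((2:ℕ):ℝ) * (x^2/4) = x^2/2 by push_cast; ring]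
  have hf : (0:ℝ) < n.factorial := by positivity
  have he : Real.exp (-(x^2)/2) = (Real.exp (x^2/2))⁻¹ := by rw [← Real.exp_neg]; ring_nf
  rw [he, ← div_eq_mul_inv, div_div, div_le_iff₀ (by positivity)] at key
  linarith

lemma two_pi_bound : (2 * Real.pi) ^ ((3 : ℝ)/4) ≤ 4 := by
  have h : (2 * Real.pi) ^ ((3 : ℝ)/4) = ((2*Real.pi)^(3:ℕ)) ^ ((1:ℝ)/4) := by
    rw [← Real.rpow_natCast, ← Real.rpow_mul (by positivity)]; norm_num
  have h4 : (4:ℝ) = ((4:ℝ)^(4:ℕ)) ^ ((1:ℝ)/4) := by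
    rw [← Real.rpow_natCast, ← Real.rpow_mul (by positivity)]; norm_num
  rw [h]
  conv_rhs => rw [h4]
  apply Real.rpow_le_rpow (by positivity) _ (by norm_num)
  have hp := Real.pi_lt_d2
  have : (2*Real.pi)^3 ≤ (6.3:ℝ)^3 := pow_le_pow_left₀ (by positivity) (by linarith) 3
  linarith

lemma gammaPert_bound (m : ℕ) (hm : 3 ≤ m) (k : ℕ) (hk : k < m) (u : ℝ) :
    |gammaPert (2*k+1) u| ≤ 3^k * (16 * m * Real.exp (-(u^2)/(2*m)) / √(2*Real.pi)) := by
  have hm' : (3:ℝ) ≤ m := by exact_mod_cast hm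
  have hk' : (k:ℝ) + 1 ≤ m := by exact_mod_cast hk
  set j := 2*k+1 with hj
  have hjr : (j:ℝ) = 2*k+1 := by rw [hj]; push_cast; ring
  have hc := cramer j (by omega) (2*u/√3)
  have hx : (2*u/√3)^2/4 = u^2/3 := by
    rw [div_pow, Real.sq_sqrt (by norm_num)]; ring
  rw [hx] at hc
  have hf : (0:ℝ) < j.factorial := by positivity
  have h3 : √((3:ℝ)^j / j.factorial) * √(j.factorial:ℝ) = 3^k * √3 := by
    rw [← Real.sqrt_mul (by positivity), div_mul_cancel₀ _ hf.ne', hj, pow_succ, pow_mul',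
      Real.sqrt_mul (by positivity), Real.sqrt_sq (by positivity)]
  have hconst : √2 * √3 * √(4*j) ≤ 4*m := by
    rw [← Real.sqrt_mul (by norm_num), ← Real.sqrt_mul (by norm_num)]
    apply Real.sqrt_le_iff.2 ⟨by positivity, ?_⟩
    rw [hjr]
    nlinarith
  have hexp : Real.exp (-(u^2)/2) * Real.exp (u^2/3) ≤ Real.exp (-(u^2)/(2*m)) := by
    rw [← Real.exp_add, Real.exp_le_exp]
    have : u^2/(2*m) ≤ u^2/6 := div_le_div_of_nonneg_left (sq_nonneg u) (by norm_num) (by linarith)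
    have e : -(u^2)/(2*m) = -(u^2/(2*m)) := by ring
    rw [e]; linarith
  unfold gammaPert gauss
  rw [abs_mul, abs_of_nonneg (show 0 ≤ √2 * (2 * Real.pi) ^ ((3 : ℝ)/4) *
    √(3 ^ j / (Nat.factorial j)) * (Real.exp (-(u^2)/2) / √(2*Real.pi)) by positivity)]
  calc _ ≤ √2 * (2 * Real.pi) ^ ((3 : ℝ)/4) *
    √(3 ^ j / (Nat.factorial j)) * (Real.exp (-(u^2)/2) / √(2*Real.pi)) *
      (√(4*j) * √(j.factorial : ℝ) * Real.exp (u^2/3)) :=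
        mul_le_mul_of_nonneg_left hc (by positivity)
    _ = (√2 * √3 * √(4*j)) * (2 * Real.pi) ^ ((3 : ℝ)/4) * 3^k *
      (Real.exp (-(u^2)/2) * Real.exp (u^2/3)) / √(2*Real.pi) := by
        linear_combination (√2 * √(4*j) * (2 * Real.pi) ^ ((3 : ℝ)/4) *
          (Real.exp (-(u^2)/2) * Real.exp (u^2/3)) / √(2*Real.pi)) * h3
    _ ≤ (4*m) * 4 * 3^k * Real.exp (-(u^2)/(2*m)) / √(2*Real.pi) := by
        have := two_pi_bound
        gcongr
    _ = _ := by ring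

lemma sum_bound (m : ℕ) (hm : 3 ≤ m) (u : ℝ) :
    ∑ k : Fin m, |gammaPert (2*(k:ℕ)+1) u| ≤ (8 * m * √m * 3^m) * gaussVar m u := by
  have h1 : ∑ k : Fin m, |gammaPert (2*(k:ℕ)+1) u| ≤
      ∑ k : Fin m, (3:ℝ)^(k:ℕ) * (16 * m * Real.exp (-(u^2)/(2*m)) / √(2*Real.pi)) :=
    Finset.sum_le_sum fun k _ => gammaPert_bound m hm k k.2 u
  refine h1.trans ?_
  rw [← Finset.sum_mul, Fin.sum_univ_eq_sum_range (fun k => (3:ℝ)^k), geom_sum_eq (by norm_num)]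
  unfold gaussVar
  have hm0 : (0:ℝ) < m := by exact_mod_cast (by omega : 0 < m)
  have hs : √(m:ℝ) ≠ 0 := (Real.sqrt_pos.2 hm0).ne'
  have hp : 0 < √(2*Real.pi) := Real.sqrt_pos.2 (by positivity)
  rw [Real.sqrt_mul (by positivity : 0 ≤ 2*Real.pi) (m:ℝ)]
  have : 8 * m * √m * 3^m * (Real.exp (-(u^2)/(2*m)) / (√(2*Real.pi) * √m)) =
      (3^m/2) * (16 * m * Real.exp (-(u^2)/(2*m)) / √(2*Real.pi)) := by
    field_simp
    ring
  rw [this]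
  apply mul_le_mul_of_nonneg_right _ (by positivity)
  linarith

theorem stmt10 (d m n : ℕ) (hd : 1 ≤ d) (hm : 3 ≤ m) (hn : 2 ≤ n)
    (hcond : (m : ℝ) ^ ((5 * (d : ℝ))/4) * 8 ^ d * 3 ^ (d * m) ≤ Real.sqrt n)
    (c : ℝ) (hc : 0 < c ∧ c < 1)
    (ε : ℝ) (hε : ε = c * (n : ℝ) ^ (-(1 : ℝ)/2) * (m : ℝ) ^ (-(d : ℝ)/4))
    (α : (Fin d → Fin m) → ℝ) (hα : ∀ k, α k = 0 ∨ α k = 1)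
    (u : Fin d → ℝ) :
    (1 - c) * ∏ i, gaussVar m (u i) ≤
      (∏ i, gaussVar m (u i)) +
        ε * ∑ k : Fin d → Fin m, α k * ∏ i, gammaPert (2 * (k i : ℕ) + 1) (u i) ∧
    0 ≤ (1 - c) * ∏ i, gaussVar m (u i) := by
  have hg : ∀ x, 0 ≤ gaussVar m x := fun x => by unfold gaussVar; positivity
  have hP : 0 ≤ ∏ i, gaussVar m (u i) := Finset.prod_nonneg fun i _ => hg _
  refine ⟨?_, mul_nonneg (by linarith [hc.2]) hP⟩
  have hm0 : (0:ℝ) < m := by exact_mod_cast (by omega : 0 < m)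
  have hn0 : (0:ℝ) < n := by exact_mod_cast (by omega : 0 < n)
  set S := ∑ k : Fin d → Fin m, α k * ∏ i, gammaPert (2 * (k i : ℕ) + 1) (u i) with hS
  have hSb : |S| ≤ (8 * m * √m * 3^m)^d * ∏ i, gaussVar m (u i) := by
    calc |S| ≤ ∑ k : Fin d → Fin m, |α k * ∏ i, gammaPert (2 * (k i : ℕ) + 1) (u i)| :=
          Finset.abs_sum_le_sum_abs _ _
      _ ≤ ∑ k : Fin d → Fin m, ∏ i, |gammaPert (2 * (k i : ℕ) + 1) (u i)| := by
          apply Finset.sum_le_sum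
          intro k _
          rw [abs_mul, Finset.abs_prod]
          have : 0 ≤ ∏ i, |gammaPert (2 * (k i : ℕ) + 1) (u i)| :=
            Finset.prod_nonneg fun i _ => abs_nonneg _
          rcases hα k with h | h <;> rw [h] <;> simp [this]
      _ = ∏ i, ∑ k : Fin m, |gammaPert (2 * (k : ℕ) + 1) (u i)| := by
          rw [Finset.prod_univ_sum]
          simp
      _ ≤ ∏ i, ((8 * m * √m * 3^m) * gaussVar m (u i)) :=
          Finset.prod_le_prod (fun i _ => Finset.sum_nonneg fun k _ => abs_nonneg _)
            fun i _ => sum_bound m hm (u i)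
      _ = _ := by rw [Finset.prod_mul_distrib]; simp
  have hε0 : 0 ≤ ε := by rw [hε]; have := hc.1; positivity
  have hεb : ε * (8 * m * √m * 3^m)^d ≤ c := by
    have e1 : (n:ℝ)^(-(1:ℝ)/2) = (√n)⁻¹ := by
      rw [neg_div, Real.rpow_neg hn0.le, Real.sqrt_eq_rpow]
    have e2 : (m:ℝ)^(-(d:ℝ)/4) * (8 * m * √m * 3^m)^d =
        (m : ℝ) ^ ((5 * (d : ℝ))/4) * 8 ^ d * 3 ^ (d * m) := by
      have e3 : ((m:ℝ) * √m)^d = (m:ℝ)^((3*(d:ℝ))/2) := by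
        rw [Real.sqrt_eq_rpow]
        nth_rewrite 1 [← Real.rpow_one (m:ℝ)]
        rw [← Real.rpow_add hm0, ← Real.rpow_natCast, ← Real.rpow_mul hm0.le]
        congr 1; ring
      have e4 : (8 * m * √m * 3^m)^d = ((m:ℝ) * √m)^d * 8^d * 3^(d*m) := by
        rw [mul_comm d m, pow_mul, ← mul_pow, ← mul_pow]; congr 1; ring
      rw [e4, e3, ← mul_assoc, ← mul_assoc, ← Real.rpow_add hm0]
      congr 3; ring
    rw [hε, e1, mul_assoc, e2, mul_assoc]
    have hsn : 0 < √(n:ℝ) := Real.sqrt_pos.2 hn0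
    have : (√(n:ℝ))⁻¹ * ((m : ℝ) ^ ((5 * (d : ℝ))/4) * 8 ^ d * 3 ^ (d * m)) ≤ 1 := by
      rw [inv_mul_le_iff₀ hsn]; linarith
    nlinarith [mul_le_mul_of_nonneg_left this hc.1.le]
  have h1 : -(ε * |S|) ≤ ε * S := by nlinarith [neg_abs_le S]
  have h2 : ε * |S| ≤ c * ∏ i, gaussVar m (u i) := by
    refine (mul_le_mul_of_nonneg_left hSb hε0).trans ?_
    rw [← mul_assoc]
    exact mul_le_mul_of_nonneg_right hεb hP
  linarith
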